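/- arXiv:1306.5093 — 4 statements merged into one kernel-verified Lean document; each statement's English description precedes it below -/
import Mathlib

section
/- Fix an integer N ≥ 1, a real σ_w > 0, and p ∈ (0,1). For each integer K ≥ 1 let ξ⁺_K := 1 + √(1 + σ_w²/K) and ξ⁻_K := 1 − √(1 + σ_w²/K), and for real s define Φ_K(s) := Σ_{ℓ=0}^{K} C(K,ℓ) p^ℓ (1−p)^{K−ℓ} · ( [1 + (ξ⁺_K/2 − ℓ/K)s]·[1 + (ξ⁻_K/2 − ℓ/K)s] )^{−N}. Then for every real s with |s| < 2/(1 + √(1 + σ_w²)), lim_{K→∞} Φ_K(s) = ( [1 + (1−p)s]·[1 − p s] )^{−N}. -/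
open Finset Filter Topology unitInterval

/-- Bernstein sums of a convergent sequence of continuous functions on `[0,1]` converge. -/
theorem tendsto_bernsteinApproximation_apply_of_tendsto {f : ℕ → C(I, ℝ)} {g : C(I, ℝ)}
    (hf : Tendsto f atTop (𝓝 g)) (x : I) :
    Tendsto (fun n => bernsteinApproximation n (f n) x) atTop (𝓝 (g x)) := by
  have hg : Tendsto (fun n => bernsteinApproximation n g x) atTop (𝓝 (g x)) :=
    ((continuous_eval_const x).tendsto g).comp (bernsteinApproximation_uniform g)
  have hdiff : Tendsto (fun n => bernsteinApproximation n (f n) x - bernsteinApproximation n g x)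
      atTop (𝓝 0) := by
    refine squeeze_zero_norm (fun n => ?_) (tendsto_iff_norm_sub_tendsto_zero.mp hf)
    rw [bernsteinApproximation.apply, bernsteinApproximation.apply, ← Finset.sum_sub_distrib]
    calc _ ≤ ∑ k : Fin (n + 1), bernstein n k x * ‖f n - g‖ := by
          refine norm_sum_le_of_le _ fun k _ => ?_
          rw [← smul_sub, norm_smul, Real.norm_of_nonneg bernstein_nonneg]
          exact mul_le_mul_of_nonneg_left
            ((f n - g).norm_coe_le_norm (bernstein.z k)) bernstein_nonneg
      _ = ‖f n - g‖ := by rw [← Finset.sum_mul, bernstein.probability, one_mul]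
  simpa using hdiff.add hg

/-- Both affine factors are positive in the region `1 ≤ t ≤ τ`, `0 ≤ x ≤ 1`,
`|s| < 2 / (1 + τ)`. -/
theorem factors_pos {s t τ x : ℝ} (hs : |s| < 2 / (1 + τ)) (ht : t ∈ Set.Icc 1 τ)
    (hx : x ∈ I) :
    0 < 1 + ((1 + t) / 2 - x) * s ∧ 0 < 1 + ((1 - t) / 2 - x) * s := by
  obtain ⟨ht₁, htτ⟩ := ht
  obtain ⟨hx₀, hx₁⟩ := hx
  have hsτ : |s| * (1 + τ) < 2 := (lt_div_iff₀ (by linarith)).mp hs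
  have key : ∀ a : ℝ, |a| ≤ (1 + τ) / 2 → 0 < 1 + a * s := fun a ha => by
    have h₁ : |a * s| ≤ (1 + τ) / 2 * |s| := by
      rw [abs_mul]
      gcongr
    linarith [neg_abs_le (a * s)]
  exact ⟨key _ (abs_le.mpr ⟨by linarith, by linarith⟩),
    key _ (abs_le.mpr ⟨by linarith, by linarith⟩)⟩

/-- Proposition 3, IPC case (Eqs. (16)-(17)): large-system limit of the
channel-averaged conditional MGF of the scaled MRC statistic, with `σ_w` fixed
(individual power constraint).  For `|s| < 2/(1 + √(1+σ_w²))`,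
`Φ_K(s) → ([1+(1-p)s][1-ps])^{-N}` as `K → ∞`. -/
theorem stmt_8
    (N : ℕ) (hN : 1 ≤ N) (σw : ℝ) (hσw : 0 < σw)
    (p : ℝ) (hp : p ∈ Set.Ioo (0 : ℝ) 1) :
    ∀ s : ℝ, |s| < 2 / (1 + Real.sqrt (1 + σw ^ 2)) →
      Filter.Tendsto (fun K : ℕ =>
          ∑ ℓ ∈ Finset.range (K + 1),
            (K.choose ℓ : ℝ) * p ^ ℓ * (1 - p) ^ (K - ℓ)
              * ((1 + ((1 + Real.sqrt (1 + σw ^ 2 / K)) / 2 - (ℓ : ℝ) / K) * s)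
                  * (1 + ((1 - Real.sqrt (1 + σw ^ 2 / K)) / 2 - (ℓ : ℝ) / K) * s))⁻¹ ^ N)
        Filter.atTop
        (nhds (((1 + (1 - p) * s) * (1 - p * s))⁻¹ ^ N)) := by
  intro s hs
  set τ := Real.sqrt (1 + σw ^ 2)
  let F : C(Set.Icc 1 τ × I, ℝ) :=
    { toFun := fun q => ((1 + ((1 + (q.1 : ℝ)) / 2 - (q.2 : ℝ)) * s)
        * (1 + ((1 - (q.1 : ℝ)) / 2 - (q.2 : ℝ)) * s))⁻¹ ^ N
      continuous_toFun := by
        refine (Continuous.inv₀ (by fun_prop) fun q => ?_).pow N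
        have h := factors_pos hs q.1.2 q.2.2
        exact (mul_pos h.1 h.2).ne' }
  have hmem : ∀ K : ℕ, Real.sqrt (1 + σw ^ 2 / K) ∈ Set.Icc 1 τ := fun K => by
    refine ⟨Real.one_le_sqrt.mpr (le_add_of_nonneg_right (by positivity)),
      Real.sqrt_le_sqrt (add_le_add_right ?_ 1)⟩
    rcases K.eq_zero_or_pos with rfl | hK
    · simpa using sq_nonneg σw
    · exact div_le_self (sq_nonneg _) (by exact_mod_cast hK)
  have hone : (1 : ℝ) ∈ Set.Icc 1 τ := ⟨le_rfl, (hmem 0).1.trans (hmem 0).2⟩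
  have hsqrt : Tendsto (fun K : ℕ => (⟨_, hmem K⟩ : Set.Icc 1 τ)) atTop (𝓝 ⟨1, hone⟩) := by
    refine tendsto_subtype_rng.mpr ?_
    simpa using ((tendsto_const_div_atTop_nhds_zero_nat (σw ^ 2)).const_add 1).sqrt
  have hlim := tendsto_bernsteinApproximation_apply_of_tendsto
    ((F.curry.continuous.tendsto _).comp hsqrt) ⟨p, Set.Ioo_subset_Icc_self hp⟩
  convert hlim using 1
  · funext K
    rw [bernsteinApproximation.apply, Finset.sum_range]
    refine Finset.sum_congr rfl fun k _ => ?_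
    rw [bernstein_apply]
    rfl
  · congr 1
    simp only [ContinuousMap.curry_apply, F, ContinuousMap.coe_mk]
    ring_nf
end

section
/- Let K ≥ 1 and N ≥ 1 be integers and σ_w > 0 real; for ℓ ∈ {0,…,K} set a_ℓ := (1/2)(K ξ⁺ − 2ℓ) and b_ℓ := (1/2)(K ξ⁻ − 2ℓ), where ξ⁺ := 1 + √(1 + σ_w²/K) and ξ⁻ := 1 − √(1 + σ_w²/K). Let p : {0,…,K} → [0,1] with Σ_{ℓ=0}^K p_ℓ = 1 and define Φ(s) := Σ_{ℓ=0}^K p_ℓ · ((1 + a_ℓ s)(1 + b_ℓ s))^{−N} for real s in a neighborhood of 0. Then Φ''(0) − (Φ'(0))² = K²N(1 + σ_w²/(2K)) − 2KN·m₁ + 2N·m₂ + 4N²·(m₂ − m₁²), where m₁ := Σ_ℓ ℓ p_ℓ and m₂ := Σ_ℓ ℓ² p_ℓ. -/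
open Finset

theorem hasDerivAt_inv_quadratic_pow (a b : ℝ) (n : ℕ) {s : ℝ}
    (hs : (1 + a * s) * (1 + b * s) ≠ 0) :
    HasDerivAt (fun s : ℝ => ((1 + a * s) * (1 + b * s))⁻¹ ^ n)
      (-n * ((1 + a * s) * (1 + b * s))⁻¹ ^ (n + 1) * (a + b + 2 * (a * b) * s)) s := by
  have linear (c : ℝ) : HasDerivAt (fun s : ℝ => 1 + c * s) c s := by
    simpa using ((hasDerivAt_id s).const_mul c).const_add 1
  refine ((((linear a).mul (linear b)).inv hs).pow n).congr_deriv ?_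
  rcases n with _ | n
  · simp
  · simp only [Pi.inv_apply, Pi.mul_apply, Nat.add_sub_cancel, div_eq_mul_inv, ← inv_pow]
    ring

theorem eventually_quadratic_ne_zero (a b : ℝ) :
    ∀ᶠ s : ℝ in nhds 0, (1 + a * s) * (1 + b * s) ≠ 0 := by
  have hc : ContinuousAt (fun s : ℝ => (1 + a * s) * (1 + b * s)) 0 := by fun_prop
  exact hc.eventually_ne (by simp)

theorem deriv_sum_inv_quadratic_pow_eventuallyEq {ι : Type*} (t : Finset ι) (p a b : ι → ℝ)
    (n : ℕ) :
    deriv (fun s : ℝ => ∑ i ∈ t, p i * ((1 + a i * s) * (1 + b i * s))⁻¹ ^ n) =ᶠ[nhds 0]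
      fun s => ∑ i ∈ t, p i * (-n * ((1 + a i * s) * (1 + b i * s))⁻¹ ^ (n + 1) *
        (a i + b i + 2 * (a i * b i) * s)) := by
  have h : ∀ᶠ s : ℝ in nhds 0, ∀ i ∈ t, (1 + a i * s) * (1 + b i * s) ≠ 0 :=
    (Filter.eventually_all_finset t).2 fun i _ => eventually_quadratic_ne_zero (a i) (b i)
  filter_upwards [h] with s hs
  exact (HasDerivAt.fun_sum fun i hi =>
    (hasDerivAt_inv_quadratic_pow (a i) (b i) n (hs i hi)).const_mul (p i)).deriv

theorem deriv_sum_inv_quadratic_pow_zero {ι : Type*} (t : Finset ι) (p a b : ι → ℝ) (n : ℕ) :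
    deriv (fun s : ℝ => ∑ i ∈ t, p i * ((1 + a i * s) * (1 + b i * s))⁻¹ ^ n) 0 =
      ∑ i ∈ t, p i * (-n * (a i + b i)) := by
  rw [(deriv_sum_inv_quadratic_pow_eventuallyEq t p a b n).eq_of_nhds]
  simp

theorem deriv_deriv_sum_inv_quadratic_pow_zero {ι : Type*} (t : Finset ι) (p a b : ι → ℝ)
    (n : ℕ) :
    deriv (deriv (fun s : ℝ => ∑ i ∈ t, p i * ((1 + a i * s) * (1 + b i * s))⁻¹ ^ n)) 0 =
      ∑ i ∈ t, p i * (n * (n + 1) * (a i + b i) ^ 2 - 2 * n * (a i * b i)) := by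
  rw [(deriv_sum_inv_quadratic_pow_eventuallyEq t p a b n).deriv_eq]
  refine (HasDerivAt.fun_sum fun i _ => ?_).deriv
  have hq := hasDerivAt_inv_quadratic_pow (a i) (b i) (n + 1) (s := 0) (by simp)
  have hl : HasDerivAt (fun s : ℝ => a i + b i + 2 * (a i * b i) * s) (2 * (a i * b i)) 0 := by
    simpa using ((hasDerivAt_id (0 : ℝ)).const_mul (2 * (a i * b i))).const_add (a i + b i)
  refine (((hq.const_mul (-n : ℝ)).mul hl).const_mul (p i)).congr_deriv ?_
  simp only [mul_zero, add_zero, mul_one, inv_one, one_pow, Nat.cast_add, Nat.cast_one]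
  ring

/-- Proposition 5 (variance formula): with `a_ℓ = (1/2)(Kξ⁺-2ℓ)`, `b_ℓ = (1/2)(Kξ⁻-2ℓ)`,
`ξ± = 1 ± √(1+σ_w²/K)`, and a pmf `p` on `{0,…,K}`, the MGF
`Φ(s) = Σ_ℓ p_ℓ ((1+a_ℓ s)(1+b_ℓ s))^{-N}` satisfies
`Φ''(0) - (Φ'(0))² = K²N(1+σ_w²/(2K)) - 2KN·m₁ + 2N·m₂ + 4N²(m₂ - m₁²)`,
where `m₁ = Σ_ℓ ℓ p_ℓ` and `m₂ = Σ_ℓ ℓ² p_ℓ`. -/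
theorem stmt_12
    (K N : ℕ) (hK : 1 ≤ K) (hN : 1 ≤ N) (σw : ℝ) (hσw : 0 < σw)
    (p : ℕ → ℝ) (hp : ∀ ℓ, ℓ ≤ K → p ℓ ∈ Set.Icc (0 : ℝ) 1)
    (hsum : ∑ ℓ ∈ Finset.range (K + 1), p ℓ = 1) :
    deriv (deriv (fun s : ℝ =>
        ∑ ℓ ∈ Finset.range (K + 1),
          p ℓ * ((1 + (1/2 * ((K : ℝ) * (1 + Real.sqrt (1 + σw ^ 2 / K)) - 2 * ℓ)) * s)
              * (1 + (1/2 * ((K : ℝ) * (1 - Real.sqrt (1 + σw ^ 2 / K)) - 2 * ℓ)) * s))⁻¹ ^ N)) 0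
      - (deriv (fun s : ℝ =>
        ∑ ℓ ∈ Finset.range (K + 1),
          p ℓ * ((1 + (1/2 * ((K : ℝ) * (1 + Real.sqrt (1 + σw ^ 2 / K)) - 2 * ℓ)) * s)
              * (1 + (1/2 * ((K : ℝ) * (1 - Real.sqrt (1 + σw ^ 2 / K)) - 2 * ℓ)) * s))⁻¹ ^ N) 0) ^ 2
      = (K : ℝ) ^ 2 * N * (1 + σw ^ 2 / (2 * K))
        - 2 * K * N * (∑ ℓ ∈ Finset.range (K + 1), (ℓ : ℝ) * p ℓ)
        + 2 * N * (∑ ℓ ∈ Finset.range (K + 1), (ℓ : ℝ) ^ 2 * p ℓ)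
        + 4 * N ^ 2 * ((∑ ℓ ∈ Finset.range (K + 1), (ℓ : ℝ) ^ 2 * p ℓ)
            - (∑ ℓ ∈ Finset.range (K + 1), (ℓ : ℝ) * p ℓ) ^ 2) := by
  have hK0 : (K : ℝ) ≠ 0 := by positivity
  have hsq : Real.sqrt (1 + σw ^ 2 / K) ^ 2 = 1 + σw ^ 2 / K := Real.sq_sqrt (by positivity)
  have hprod (ℓ : ℕ) : 1 / 2 * ((K : ℝ) * (1 + Real.sqrt (1 + σw ^ 2 / K)) - 2 * ℓ) *
      (1 / 2 * ((K : ℝ) * (1 - Real.sqrt (1 + σw ^ 2 / K)) - 2 * ℓ)) =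
      (ℓ : ℝ) ^ 2 - K * ℓ - K * σw ^ 2 / 4 := by
    have hKsq : (K : ℝ) ^ 2 * Real.sqrt (1 + σw ^ 2 / K) ^ 2 = K ^ 2 + K * σw ^ 2 := by
      rw [hsq]
      field_simp
    linear_combination (-1 / 4) * hKsq
  have hadd (ℓ : ℕ) : 1 / 2 * ((K : ℝ) * (1 + Real.sqrt (1 + σw ^ 2 / K)) - 2 * ℓ) +
      1 / 2 * ((K : ℝ) * (1 - Real.sqrt (1 + σw ^ 2 / K)) - 2 * ℓ) = K - 2 * ℓ := by
    ring
  rw [deriv_deriv_sum_inv_quadratic_pow_zero, deriv_sum_inv_quadratic_pow_zero]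
  simp only [hprod, hadd]
  have hfirst : ∑ ℓ ∈ Finset.range (K + 1), p ℓ * (-N * ((K : ℝ) - 2 * ℓ)) =
      -N * K + 2 * N * ∑ ℓ ∈ Finset.range (K + 1), (ℓ : ℝ) * p ℓ := by
    rw [← mul_one (-N * K : ℝ), ← hsum, Finset.mul_sum, Finset.mul_sum,
      ← Finset.sum_add_distrib]
    exact Finset.sum_congr rfl fun ℓ _ => by ring
  have hsecond : ∑ ℓ ∈ Finset.range (K + 1), p ℓ * (N * (N + 1) * ((K : ℝ) - 2 * ℓ) ^ 2 -
        2 * N * ((ℓ : ℝ) ^ 2 - K * ℓ - K * σw ^ 2 / 4)) =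
      (N * (N + 1) * K ^ 2 + N * K * σw ^ 2 / 2) * 1 +
        (2 * N * K - 4 * N * (N + 1) * K) * ∑ ℓ ∈ Finset.range (K + 1), (ℓ : ℝ) * p ℓ +
        (4 * N * (N + 1) - 2 * N) * ∑ ℓ ∈ Finset.range (K + 1), (ℓ : ℝ) ^ 2 * p ℓ := by
    rw [← hsum, Finset.mul_sum, Finset.mul_sum, Finset.mul_sum, ← Finset.sum_add_distrib,
      ← Finset.sum_add_distrib]
    exact Finset.sum_congr rfl fun ℓ _ => by ring
  rw [hfirst, hsecond]
  field_simp
  ring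
end

section
/- Let K ≥ 1, N ≥ 1 and SNR > 0 be real numbers, and let P_D, P_F ∈ [0,1]. For i ∈ {0,1} let p₀ := P_F, p₁ := P_D and ρ_i := p_i(1−p_i). Define mean_i := 2NK p_i − KN and var_i := K²N(1 + 1/(2·SNR)) − 2KN·(K p_i) + 2N·(K ρ_i + K² p_i²) + 4N²·K ρ_i. Then var_i = NK·( K(1 + 1/(2·SNR)) + 2(2N+1−K)ρ_i ), this quantity is strictly positive, and (mean₁ − mean₀)² / var_i = 4NK(P_D − P_F)² / ( K(1 + 1/(2·SNR)) + 2(2N+1−K)ρ_i ). -/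
/-- Corollary (Eq. (26)): the deflection coefficients of the MRC rule under
conditionally i.i.d. sensor decisions.  With `p₀ = P_F`, `p₁ = P_D`,
`ρ_i = p_i(1-p_i)`, `mean_i = 2NKp_i - KN` and
`var_i = K²N(1+1/(2SNR)) - 2KN·(Kp_i) + 2N·(Kρ_i + K²p_i²) + 4N²·Kρ_i`, one has
`var_i = NK(K(1+1/(2SNR)) + 2(2N+1-K)ρ_i) > 0` and
`(mean₁-mean₀)²/var_i = 4NK(P_D-P_F)²/(K(1+1/(2SNR)) + 2(2N+1-K)ρ_i)`. -/
theorem stmt_13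
    (K N SNR : ℝ) (hK : 1 ≤ K) (hN : 1 ≤ N) (hSNR : 0 < SNR)
    (PD PF : ℝ) (hPD : PD ∈ Set.Icc (0 : ℝ) 1) (hPF : PF ∈ Set.Icc (0 : ℝ) 1) :
    ∀ i : Fin 2,
      let p : Fin 2 → ℝ := ![PF, PD]
      let ρ : Fin 2 → ℝ := fun j => p j * (1 - p j)
      let mean : Fin 2 → ℝ := fun j => 2 * N * K * p j - K * N
      let var : Fin 2 → ℝ := fun j =>
        K ^ 2 * N * (1 + 1 / (2 * SNR)) - 2 * K * N * (K * p j)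
          + 2 * N * (K * ρ j + K ^ 2 * (p j) ^ 2) + 4 * N ^ 2 * (K * ρ j)
      var i = N * K * (K * (1 + 1 / (2 * SNR)) + 2 * (2 * N + 1 - K) * ρ i)
      ∧ 0 < var i
      ∧ (mean 1 - mean 0) ^ 2 / var i
          = 4 * N * K * (PD - PF) ^ 2
              / (K * (1 + 1 / (2 * SNR)) + 2 * (2 * N + 1 - K) * ρ i) := by
  intro i p ρ mean var
  have hp : p i ∈ Set.Icc (0 : ℝ) 1 := by
    fin_cases i
    · exact hPF
    · exact hPD
  have hρ : 0 ≤ ρ i := mul_nonneg hp.1 (sub_nonneg.mpr hp.2)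
  have hρ' : ρ i ≤ 1 / 4 := by
    change p i * (1 - p i) ≤ 1 / 4
    nlinarith [sq_nonneg (2 * p i - 1)]
  have hvar : var i = N * K * (K * (1 + 1 / (2 * SNR)) + 2 * (2 * N + 1 - K) * ρ i) := by
    simp only [var, ρ]
    ring
  have hNK : 0 < N * K := by positivity
  have hden : 0 < K * (1 + 1 / (2 * SNR)) + 2 * (2 * N + 1 - K) * ρ i := by
    have hnoise : 0 < K * (1 / (2 * SNR)) := by positivity
    have hsignal : 0 ≤ (2 * N + 1) * ρ i := by positivity
    have hquad : 0 ≤ K * (1 / 4 - ρ i) := mul_nonneg (by linarith) (by linarith)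
    linarith
  refine ⟨hvar, hvar ▸ mul_pos hNK hden, ?_⟩
  have hmean : (mean 1 - mean 0) ^ 2 = N * K * (4 * N * K * (PD - PF) ^ 2) := by
    simp only [mean, p, Matrix.cons_val_zero, Matrix.cons_val_one]
    ring
  rw [hvar, hmean, mul_div_mul_left _ _ hNK.ne']
end

section
/- Let N ≥ 1 be real, d ≠ 0 real, ρ ∈ (0, 1/2), c ≥ 1 real, and β ≥ 0 real. Then the function K ↦ 4NK d² / ( cK + β + 2(2N+1−K)ρ ) is well defined (its denominator is strictly positive) and strictly increasing on the interval K ∈ (0, ∞). -/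
/-- Section V: the MRC deflection coefficient
`K ↦ 4NKd²/(cK + β + 2(2N+1-K)ρ)` (with `c = 1 + 1/(2SNR)`, `β = 0` under TPC and
`c = 1`, `β = σ_w²/2` under IPC) has strictly positive denominator and is strictly
increasing in the number of sensors `K` on `(0,∞)`. -/
theorem stmt_16
    (N : ℝ) (hN : 1 ≤ N) (d : ℝ) (hd : d ≠ 0)
    (ρ : ℝ) (hρ : ρ ∈ Set.Ioo (0 : ℝ) (1/2)) (c : ℝ) (hc : 1 ≤ c) (β : ℝ) (hβ : 0 ≤ β) :
    (∀ K : ℝ, 0 < K → 0 < c * K + β + 2 * (2 * N + 1 - K) * ρ)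
    ∧ StrictMonoOn (fun K : ℝ => 4 * N * K * d ^ 2 / (c * K + β + 2 * (2 * N + 1 - K) * ρ))
        (Set.Ioi (0 : ℝ)) := by
  obtain ⟨hρ0, hρ1⟩ := hρ
  have hB : 0 < β + 2 * (2 * N + 1) * ρ := by positivity
  have hpos : ∀ K : ℝ, 0 < K → 0 < c * K + β + 2 * (2 * N + 1 - K) * ρ := by
    intro K hK
    have hslope : 0 < (c - 2 * ρ) * K := mul_pos (by linarith) hK
    linarith
  refine ⟨hpos, fun x hx y hy hxy => ?_⟩
  have hA : 0 < 4 * N * d ^ 2 := by positivity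
  have hcross : 0 < 4 * N * d ^ 2 * ((y - x) * (β + 2 * (2 * N + 1) * ρ)) :=
    mul_pos hA (mul_pos (sub_pos.2 hxy) hB)
  refine (div_lt_div_iff₀ (hpos x hx) (hpos y hy)).2 ?_
  linarith
end
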